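/- In the setting of the previous statement, if Ψ : ℝ^d → ℝ is such that Ψ(Z) is integrable, then for every x ∈ ℝ^p with h(x|B) < ∞, a conditional expectation satisfies E[Ψ(Z) | B'Z = x] · h(x|B) = E[ Ψ(W^{x|B}) · f(W^{x|B}) / φ(W^{x|B}) ]. -/

import Mathlib

open MeasureTheory ProbabilityTheory Matrix
open scoped ENNReal

/-- The standard Gaussian density on `ℝ^n`. -/
noncomputable def stdGaussianPdf (n : ℕ) (v : Fin n → ℝ) : ℝ :=
  (2 * Real.pi) ^ (-(n : ℝ) / 2) * Real.exp (-(∑ i, v i ^ 2) / 2)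

/-- `h(x|B) = E[f(W^{x|B})/φ(W^{x|B})]`, with `W^{x|B} = Bx + (I − BB')V`, `V ∼ N(0,I_d)`. -/
noncomputable def hDensity {d p : ℕ} (f : (Fin d → ℝ) → ℝ)
    (B : Matrix (Fin d) (Fin p) ℝ) (x : Fin p → ℝ) : ℝ≥0∞ :=
  ∫⁻ v, ENNReal.ofReal
      (f (B.mulVec x + (1 - B * Bᵀ).mulVec v) /
        stdGaussianPdf d (B.mulVec x + (1 - B * Bᵀ).mulVec v))
    ∂(Measure.pi fun _ : Fin d => gaussianReal 0 1)

/-- The standard Gaussian measure on `ℝ^n`. -/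
noncomputable abbrev stdGaussianPi (n : ℕ) : Measure (Fin n → ℝ) :=
  Measure.pi fun _ => gaussianReal 0 1

theorem stdGaussianPdf_eq_prod (n : ℕ) (v : Fin n → ℝ) :
    stdGaussianPdf n v = ∏ i, gaussianPDFReal 0 1 (v i) := by
  have h2 : (0 : ℝ) ≤ 2 * Real.pi := by positivity
  simp only [stdGaussianPdf, gaussianPDFReal, NNReal.coe_one, mul_one, sub_zero,
    Finset.prod_mul_distrib, Finset.prod_const, Finset.card_univ, Fintype.card_fin,
    ← Real.exp_sum, ← Finset.sum_div, Finset.sum_neg_distrib]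
  congr 1
  rw [Real.sqrt_eq_rpow, ← Real.rpow_neg h2, ← Real.rpow_natCast, ← Real.rpow_mul h2]
  congr 1
  ring

theorem stdGaussianPdf_pos (n : ℕ) (v : Fin n → ℝ) : 0 < stdGaussianPdf n v := by
  unfold stdGaussianPdf
  positivity

theorem measurable_stdGaussianPdf (n : ℕ) : Measurable (stdGaussianPdf n) := by
  unfold stdGaussianPdf
  fun_prop

theorem stdGaussianPi_eq_withDensity (n : ℕ) :
    stdGaussianPi n = volume.withDensity fun v => ENNReal.ofReal (stdGaussianPdf n v) := by
  refine Measure.pi_eq fun s hs => ?_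
  have hg : ∀ i, Integrable (gaussianPDFReal 0 1) (volume.restrict (s i)) := fun i =>
    (integrable_gaussianPDFReal 0 1).restrict
  rw [withDensity_apply _ (MeasurableSet.univ_pi hs), volume_pi, Measure.restrict_pi_pi]
  simp_rw [stdGaussianPdf_eq_prod]
  rw [← ofReal_integral_eq_lintegral_ofReal
      (Integrable.fintype_prod_dep (f := fun _ => gaussianPDFReal 0 1) hg)
      (ae_of_all _ fun v => Finset.prod_nonneg fun i _ => gaussianPDFReal_nonneg 0 1 (v i)),
    integral_fintype_prod_eq_prod (fun _ => gaussianPDFReal 0 1),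
    ENNReal.ofReal_prod_of_nonneg fun i _ =>
      integral_nonneg fun y => gaussianPDFReal_nonneg 0 1 y]
  simp_rw [gaussianReal_apply_eq_integral 0 one_ne_zero]

theorem withDensity_eq_stdGaussianPi_withDensity_div {n : ℕ} {f : (Fin n → ℝ) → ℝ}
    (hfm : Measurable f) :
    (volume.withDensity fun z => ENNReal.ofReal (f z)) =
      (stdGaussianPi n).withDensity fun z => ENNReal.ofReal (f z / stdGaussianPdf n z) := by
  have hφ := measurable_stdGaussianPdf n
  rw [stdGaussianPi_eq_withDensity, ← withDensity_mul _ hφ.ennreal_ofReal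
    (show Measurable fun z => ENNReal.ofReal (f z / stdGaussianPdf n z) from
      (hfm.div hφ).ennreal_ofReal)]
  congr 1
  ext z
  rw [Pi.mul_apply, ← ENNReal.ofReal_mul (stdGaussianPdf_pos n z).le,
    mul_div_cancel₀ _ (stdGaussianPdf_pos n z).ne']

theorem charFunDual_stdGaussianPi (n : ℕ) (L : StrongDual ℝ (Fin n → ℝ)) :
    charFunDual (stdGaussianPi n) L =
      Complex.exp (-((∑ i, L (Pi.single i 1) ^ 2 : ℝ) : ℂ) / 2) := by
  rw [charFunDual_pi]
  simp_rw [IsGaussian.charFunDual_eq, ← Complex.exp_sum]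
  simp_rw [integral_complex_ofReal, integral_continuousLinearMap_gaussianReal,
    variance_continuousLinearMap_gaussianReal]
  congr 1
  simp [Finset.sum_div, neg_div, max_eq_left (sq_nonneg _)]

theorem measurePreserving_mulVec_add_mulVec {m n k : ℕ} {A : Matrix (Fin k) (Fin m) ℝ}
    {C : Matrix (Fin k) (Fin n) ℝ} (h : A * Aᵀ + C * Cᵀ = 1) :
    MeasurePreserving (fun q : (Fin m → ℝ) × (Fin n → ℝ) => A *ᵥ q.1 + C *ᵥ q.2)
      ((stdGaussianPi m).prod (stdGaussianPi n)) (stdGaussianPi k) := by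
  let T : ((Fin m → ℝ) × (Fin n → ℝ)) →L[ℝ] (Fin k → ℝ) :=
    (A.mulVecLin.toContinuousLinearMap).coprod C.mulVecLin.toContinuousLinearMap
  have hT : (fun q : (Fin m → ℝ) × (Fin n → ℝ) => A *ᵥ q.1 + C *ᵥ q.2) = T := by
    ext q
    simp [T]
  rw [hT]
  refine ⟨T.measurable, Measure.ext_of_charFunDual (funext fun L => ?_)⟩
  rw [charFunDual_map, charFunDual_prod]
  simp_rw [charFunDual_stdGaussianPi, ← Complex.exp_add]
  set l : Fin k → ℝ := fun i => L (Pi.single i 1) with hl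
  have hL : ∀ v, L v = l ⬝ᵥ v := fun v => by
    conv_lhs => rw [pi_eq_sum_univ' v]
    simp [dotProduct, hl, mul_comm]
  have hA : ∀ {r : ℕ} (M : Matrix (Fin k) (Fin r) ℝ),
      ∑ j, L (M *ᵥ Pi.single j 1) ^ 2 = l ⬝ᵥ (M * Mᵀ) *ᵥ l := fun M => by
    rw [← mulVec_mulVec, dotProduct_mulVec, mulVec_transpose]
    simp [hL, vecMul, dotProduct, sq]
  have key : ∑ j, L (A *ᵥ Pi.single j 1) ^ 2 + ∑ j, L (C *ᵥ Pi.single j 1) ^ 2 =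
      ∑ i, l i ^ 2 := by
    rw [hA, hA, ← dotProduct_add, ← add_mulVec, h, one_mulVec]
    simp [dotProduct, sq]
  rw [← key]
  simp [T]
  ring_nf

theorem mul_transpose_add_compl_mul_transpose_eq_one {d p : ℕ} {B : Matrix (Fin d) (Fin p) ℝ}
    (hB : Bᵀ * B = 1) : B * Bᵀ + (1 - B * Bᵀ) * (1 - B * Bᵀ)ᵀ = 1 := by
  have h : B * Bᵀ * (B * Bᵀ) = B * Bᵀ := by
    rw [Matrix.mul_assoc, ← Matrix.mul_assoc Bᵀ, hB, Matrix.one_mul]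
  simp [Matrix.sub_mul, Matrix.mul_sub, h]

theorem transpose_mulVec_add_compl_mulVec {d p : ℕ} {B : Matrix (Fin d) (Fin p) ℝ}
    (hB : Bᵀ * B = 1) (x : Fin p → ℝ) (v : Fin d → ℝ) :
    Bᵀ *ᵥ (B *ᵥ x + (1 - B * Bᵀ) *ᵥ v) = x := by
  rw [mulVec_add, mulVec_mulVec, mulVec_mulVec, hB, Matrix.mul_sub, ← Matrix.mul_assoc, hB]
  simp

theorem measurable_hDensity {d p : ℕ} {f : (Fin d → ℝ) → ℝ} (hfm : Measurable f)
    (B : Matrix (Fin d) (Fin p) ℝ) : Measurable (hDensity f B) := by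
  have hφ := measurable_stdGaussianPdf d
  refine Measurable.lintegral_prod_right' (f := fun q : (Fin p → ℝ) × (Fin d → ℝ) =>
    ENNReal.ofReal (f (B *ᵥ q.1 + (1 - B * Bᵀ) *ᵥ q.2) /
      stdGaussianPdf d (B *ᵥ q.1 + (1 - B * Bᵀ) *ᵥ q.2))) ?_
  have hT : Measurable fun q : (Fin p → ℝ) × (Fin d → ℝ) =>
      B *ᵥ q.1 + (1 - B * Bᵀ) *ᵥ q.2 := by fun_prop
  exact ((hfm.div hφ).comp hT).ennreal_ofReal

/-- If `Z` has Lebesgue density `f`, then `h(·|B)` is the density of `B'Z` with respect to the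
standard Gaussian measure. -/
theorem map_transpose_mulVec_withDensity {d p : ℕ} {f : (Fin d → ℝ) → ℝ} (hfm : Measurable f)
    {B : Matrix (Fin d) (Fin p) ℝ} (hB : Bᵀ * B = 1) :
    Measure.map (fun z => Bᵀ.mulVec z) (volume.withDensity fun z => ENNReal.ofReal (f z)) =
      (stdGaussianPi p).withDensity (hDensity f B) := by
  have hr : Measurable fun z => ENNReal.ofReal (f z / stdGaussianPdf d z) :=
    (hfm.div (measurable_stdGaussianPdf d)).ennreal_ofReal
  have hBm : Measurable fun z : Fin d → ℝ => Bᵀ *ᵥ z := by fun_prop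
  have hT := measurePreserving_mulVec_add_mulVec (mul_transpose_add_compl_mul_transpose_eq_one hB)
  refine Measure.ext_of_lintegral _ fun F hF => ?_
  have hF' : Measurable fun z => F (Bᵀ *ᵥ z) := hF.comp hBm
  rw [withDensity_eq_stdGaussianPi_withDensity_div hfm, lintegral_map hF hBm,
    lintegral_withDensity_eq_lintegral_mul _ hr hF',
    lintegral_withDensity_eq_lintegral_mul _ (measurable_hDensity hfm B) hF,
    ← hT.lintegral_comp (hr.mul hF'),
    lintegral_prod]
  swap
  · exact ((hr.mul hF').comp hT.measurable).aemeasurable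
  refine lintegral_congr fun x => ?_
  simp only [Pi.mul_apply, transpose_mulVec_add_compl_mulVec hB]
  exact lintegral_mul_const _ (hr.comp (hT.measurable.comp measurable_prodMk_left))

/-- If `Z` has Lebesgue density `f`, mean `0` and identity covariance, `B'B = I_p`, and
`Ψ(Z)` is integrable, then there is a conditional expectation
`g(x) = E[Ψ(Z) | B'Z = x]` (i.e., a disintegration version) such that
`g(x)·h(x|B) = E[Ψ(W^{x|B})·f(W^{x|B})/φ(W^{x|B})]` for every `x` with `h(x|B) < ∞`. -/
theorem condexp_times_hDensity {d p : ℕ} (hpd : p ≤ d)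
    (f : (Fin d → ℝ) → ℝ) (hfm : Measurable f) (hf : ∀ z, 0 ≤ f z)
    (hprob : IsProbabilityMeasure (volume.withDensity fun z => ENNReal.ofReal (f z)))
    (hmean : ∀ i, ∫ z : Fin d → ℝ, z i
        ∂(volume.withDensity fun z => ENNReal.ofReal (f z)) = 0)
    (hcov : ∀ i j, ∫ z : Fin d → ℝ, z i * z j
        ∂(volume.withDensity fun z => ENNReal.ofReal (f z)) = if i = j then 1 else 0)
    (B : Matrix (Fin d) (Fin p) ℝ) (hB : Bᵀ * B = 1)
    (Ψ : (Fin d → ℝ) → ℝ) (hΨm : Measurable Ψ)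
    (hΨint : Integrable Ψ (volume.withDensity fun z => ENNReal.ofReal (f z))) :
    ∃ g : (Fin p → ℝ) → ℝ, Measurable g ∧
      (∀ s : Set (Fin p → ℝ), MeasurableSet s →
        ∫ z in (fun z => Bᵀ.mulVec z) ⁻¹' s, Ψ z
            ∂(volume.withDensity fun z => ENNReal.ofReal (f z)) =
          ∫ x in s, g x
            ∂(Measure.map (fun z => Bᵀ.mulVec z)
                (volume.withDensity fun z => ENNReal.ofReal (f z)))) ∧
      ∀ x : Fin p → ℝ, hDensity f B x < ⊤ →
        g x * (hDensity f B x).toReal =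
          ∫ v, Ψ (B.mulVec x + (1 - B * Bᵀ).mulVec v) *
              (f (B.mulVec x + (1 - B * Bᵀ).mulVec v) /
                stdGaussianPdf d (B.mulVec x + (1 - B * Bᵀ).mulVec v))
            ∂(Measure.pi fun _ : Fin d => gaussianReal 0 1) := by
  have hr0 : ∀ z, 0 ≤ f z / stdGaussianPdf d z := fun z =>
    div_nonneg (hf z) (stdGaussianPdf_pos d z).le
  have hrm : Measurable fun z => f z / stdGaussianPdf d z :=
    hfm.div (measurable_stdGaussianPdf d)
  have hBm : Measurable fun z : Fin d → ℝ => Bᵀ *ᵥ z := by fun_prop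
  have hhm := measurable_hDensity hfm B
  have hT := measurePreserving_mulVec_add_mulVec (mul_transpose_add_compl_mul_transpose_eq_one hB)
  have hlaw := map_transpose_mulVec_withDensity hfm hB
  have hfin : ∀ᵐ x ∂stdGaussianPi p, hDensity f B x < ⊤ := by
    refine ae_lt_top hhm ?_
    rw [← setLIntegral_univ, ← withDensity_apply _ MeasurableSet.univ, ← hlaw]
    exact ((Measure.isProbabilityMeasure_map hBm.aemeasurable).measure_univ.trans_lt
      ENNReal.one_lt_top).ne
  have hΨr : Integrable (fun z => Ψ z * (f z / stdGaussianPdf d z)) (stdGaussianPi d) := by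
    rw [withDensity_eq_stdGaussianPi_withDensity_div hfm,
      integrable_withDensity_iff hrm.ennreal_ofReal (ae_of_all _ fun _ => ENNReal.ofReal_lt_top)]
      at hΨint
    simpa only [ENNReal.toReal_ofReal (hr0 _)] using hΨint
  let I : (Fin p → ℝ) → ℝ := fun x => ∫ v, Ψ (B *ᵥ x + (1 - B * Bᵀ) *ᵥ v) *
    (f (B *ᵥ x + (1 - B * Bᵀ) *ᵥ v) / stdGaussianPdf d (B *ᵥ x + (1 - B * Bᵀ) *ᵥ v))
    ∂stdGaussianPi d
  have hIm : Measurable I :=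
    (StronglyMeasurable.integral_prod_right'
      ((hΨm.mul hrm).comp hT.measurable).stronglyMeasurable).measurable
  have hg : ∀ x, hDensity f B x < ⊤ →
      I x / (hDensity f B x).toReal * (hDensity f B x).toReal = I x := fun x hx => by
    rcases eq_or_ne (hDensity f B x) 0 with h0 | h0
    · have hae := (lintegral_eq_zero_iff (hrm.comp
        (hT.measurable.comp measurable_prodMk_left)).ennreal_ofReal).1 h0
      have hI : I x = 0 := by
        refine integral_eq_zero_of_ae ?_
        filter_upwards [hae] with v hv
        have := le_antisymm (ENNReal.ofReal_eq_zero.1 hv) (hr0 _)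
        simp only [Function.comp_apply] at this
        simp [this]
      simp [hI]
    · exact div_mul_cancel₀ _ (ENNReal.toReal_pos h0 hx.ne).ne'
  refine ⟨fun x => I x / (hDensity f B x).toReal, hIm.div hhm.ennreal_toReal,
    fun s hs => ?_, hg⟩
  rw [hlaw, withDensity_eq_stdGaussianPi_withDensity_div hfm,
    ← integral_indicator (hBm hs), ← integral_indicator hs,
    integral_withDensity_eq_integral_toReal_smul hrm.ennreal_ofReal
      (ae_of_all _ fun _ => ENNReal.ofReal_lt_top),
    integral_withDensity_eq_integral_toReal_smul hhm hfin]
  have hs' : ∀ z, (ENNReal.ofReal (f z / stdGaussianPdf d z)).toReal •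
      ((fun z => Bᵀ *ᵥ z) ⁻¹' s).indicator Ψ z =
      ((fun z => Bᵀ *ᵥ z) ⁻¹' s).indicator (fun z => Ψ z * (f z / stdGaussianPdf d z)) z :=
    fun z => by
      by_cases hz : z ∈ (fun z => Bᵀ *ᵥ z) ⁻¹' s
      · simp [hz, ENNReal.toReal_ofReal (hr0 z), mul_comm]
      · simp [hz]
  simp_rw [hs']
  have hindInt := hΨr.indicator (hBm hs)
  rw [← hT.map_eq] at hindInt ⊢
  rw [integral_map hT.measurable.aemeasurable hindInt.aestronglyMeasurable,
    integral_prod]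
  swap
  · exact hindInt.comp_measurable hT.measurable
  refine integral_congr_ae ?_
  filter_upwards [hfin] with x hx
  by_cases hxs : x ∈ s
  · simp only [Set.indicator, Set.mem_preimage, transpose_mulVec_add_compl_mulVec hB, hxs, if_true,
      smul_eq_mul]
    rw [mul_comm, hg x hx]
  · simp [Set.indicator, transpose_mulVec_add_compl_mulVec hB, hxs]
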